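/- arXiv:math/0610463 — 7 statements merged into one kernel-verified Lean document; each statement's English description precedes it below -/
import Mathlib

section
/- Let f, g : ℝ → ℝ be quasi-periodic functions with degrees Δ_f, Δ_g, and define S(f,g) := ∫₀^{2π} f(x)·g′(x) dx − Δ_f·g(0) − (1/2)·Δ_f·Δ_g. Then S(f,g) = −S(g,f). -/
/-- The form `S(f,g) = ∫₀^{2π} f·g' − Δf·g(0) − (1/2)·Δf·Δg` on quasi-periodic functions. -/
noncomputable def Sform (f g : ℝ → ℝ) (Δf Δg : ℝ) : ℝ :=
  (∫ x in (0:ℝ)..(2 * Real.pi), f x * deriv g x) - Δf * g 0 - (1/2) * Δf * Δg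

/-- For continuously differentiable quasi-periodic functions `f, g : ℝ → ℝ`
with degrees `Δf, Δg`, the form `S` is antisymmetric: `S(f,g) = −S(g,f)`. -/
theorem statement1 (f g : ℝ → ℝ) (Δf Δg : ℝ)
    (hf : ContDiff ℝ 1 f) (hg : ContDiff ℝ 1 g)
    (hΔf : ∀ x : ℝ, f (x + 2 * Real.pi) = f x + Δf)
    (hΔg : ∀ x : ℝ, g (x + 2 * Real.pi) = g x + Δg) :
    Sform f g Δf Δg = - Sform g f Δg Δf := by
  have hparts := intervalIntegral.integral_mul_deriv_eq_deriv_mul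
    (a := 0) (b := 2 * Real.pi) (u := f) (v := g) (u' := deriv f) (v' := deriv g)
    (fun x _ => (hf.differentiable one_ne_zero x).hasDerivAt)
    (fun x _ => (hg.differentiable one_ne_zero x).hasDerivAt)
    ((hf.continuous_deriv le_rfl).intervalIntegrable _ _)
    ((hg.continuous_deriv le_rfl).intervalIntegrable _ _)
  have h1 := hΔf 0
  have h2 := hΔg 0
  rw [zero_add] at h1 h2
  have hcomm : (∫ x in (0:ℝ)..(2 * Real.pi), deriv f x * g x)
      = ∫ x in (0:ℝ)..(2 * Real.pi), g x * deriv f x := by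
    simp only [mul_comm]
  unfold Sform
  rw [hparts, hcomm, h1, h2]
  ring
end

section
/- Let f, g : ℝ → ℝ be quasi-periodic functions with degrees Δ_f, Δ_g, and define S′(f,g) := ∫₀^{2π} f(x)·g′(x) dx − Δ_g·f(0) − (1/2)·Δ_f·Δ_g (i.e., the form obtained from S by replacing the term Δ_f·g(0) with Δ_g·f(0)). Then S′(f,g) = −S′(g,f). -/
/-- The variant form `S′(f,g) = ∫₀^{2π} f·g' − Δg·f(0) − (1/2)·Δf·Δg` on quasi-periodic
functions, obtained from `S` by replacing the term `Δf·g(0)` with `Δg·f(0)`. -/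
noncomputable def Sform' (f g : ℝ → ℝ) (Δf Δg : ℝ) : ℝ :=
  (∫ x in (0:ℝ)..(2 * Real.pi), f x * deriv g x) - Δg * f 0 - (1/2) * Δf * Δg

/-- For continuously differentiable quasi-periodic functions `f, g : ℝ → ℝ`
with degrees `Δf, Δg`, the form `S′` is antisymmetric: `S′(f,g) = −S′(g,f)`. -/
theorem statement2 (f g : ℝ → ℝ) (Δf Δg : ℝ)
    (hf : ContDiff ℝ 1 f) (hg : ContDiff ℝ 1 g)
    (hΔf : ∀ x : ℝ, f (x + 2 * Real.pi) = f x + Δf)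
    (hΔg : ∀ x : ℝ, g (x + 2 * Real.pi) = g x + Δg) :
    Sform' f g Δf Δg = - Sform' g f Δg Δf := by
  have h := intervalIntegral.integral_mul_deriv_eq_deriv_mul (a := 0) (b := 2 * Real.pi)
    (u := f) (v := g) (u' := deriv f) (v' := deriv g)
    (fun x _ => (hf.differentiable one_ne_zero x).hasDerivAt)
    (fun x _ => (hg.differentiable one_ne_zero x).hasDerivAt)
    ((hf.continuous_deriv le_rfl).intervalIntegrable _ _)
    ((hg.continuous_deriv le_rfl).intervalIntegrable _ _)
  have h1 := hΔf 0
  have h2 := hΔg 0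
  rw [zero_add] at h1 h2
  have h3 : (∫ x in (0:ℝ)..(2 * Real.pi), deriv f x * g x)
      = ∫ x in (0:ℝ)..(2 * Real.pi), g x * deriv f x := by
    simp only [mul_comm]
  rw [h1, h2, h3] at h
  unfold Sform'
  rw [h]
  ring
end

section
/- Let A be a finite set with a strict linear order <, let ε : A → {−1, +1}, and let (f_i)_{i∈A}, (g_i)_{i∈A} be families of quasi-periodic functions. Define S_<(f,g) := Σ_{i∈A} ε_i·S(f_i, g_i) − (1/2)·Σ_{i<j} ε_i·ε_j·(Δ_{f_i}·Δ_{g_j} − Δ_{g_i}·Δ_{f_j}). Then S_<(f,g) = −S_<(g,f). -/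
/-- The form `S_<(f,g) = Σ_{i∈A} ε_i·S(f_i,g_i) −
(1/2)·Σ_{i<j} ε_i·ε_j·(Δ_{f_i}·Δ_{g_j} − Δ_{g_i}·Δ_{f_j})` associated with a finite set `A`,
a strict linear order `r` on `A` and a sign function `ε`. -/
noncomputable def SA {A : Type*} [Fintype A] (r : A → A → Prop) [DecidableRel r]
    (ε : A → ℝ) (f g : A → ℝ → ℝ) (Δf Δg : A → ℝ) : ℝ :=
  (∑ i, ε i * Sform (f i) (g i) (Δf i) (Δg i)) -
    (1/2) * ∑ i, ∑ j ∈ Finset.univ.filter (fun j => r i j),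
      ε i * ε j * (Δf i * Δg j - Δg i * Δf j)

/-- For a finite set `A` with a strict linear order `r`, a sign function
`ε : A → {−1,+1}` and families `(f_i)`, `(g_i)` of continuously differentiable
quasi-periodic functions with degrees `Δf_i`, `Δg_i`, the form `S_<` is antisymmetric:
`S_<(f,g) = −S_<(g,f)`. -/
theorem statement3 {A : Type*} [Fintype A] (r : A → A → Prop) [DecidableRel r]
    (hr : IsStrictTotalOrder A r)
    (ε : A → ℝ) (hε : ∀ i, ε i = 1 ∨ ε i = -1)
    (f g : A → ℝ → ℝ) (Δf Δg : A → ℝ)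
    (hf : ∀ i, ContDiff ℝ 1 (f i)) (hg : ∀ i, ContDiff ℝ 1 (g i))
    (hΔf : ∀ i, ∀ x : ℝ, f i (x + 2 * Real.pi) = f i x + Δf i)
    (hΔg : ∀ i, ∀ x : ℝ, g i (x + 2 * Real.pi) = g i x + Δg i) :
    SA r ε f g Δf Δg = - SA r ε g f Δg Δf := by
  have key : ∀ i, Sform (f i) (g i) (Δf i) (Δg i) = - Sform (g i) (f i) (Δg i) (Δf i) := by
    intro i
    have hf' : Continuous (deriv (f i)) := (hf i).continuous_deriv le_rfl
    have hg' : Continuous (deriv (g i)) := (hg i).continuous_deriv le_rfl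
    have h := intervalIntegral.integral_mul_deriv_eq_deriv_mul (a := 0) (b := 2 * Real.pi)
      (u := f i) (v := g i) (u' := deriv (f i)) (v' := deriv (g i))
      (fun x _ => ((hf i).differentiable one_ne_zero x).hasDerivAt)
      (fun x _ => ((hg i).differentiable one_ne_zero x).hasDerivAt)
      (hf'.intervalIntegrable _ _) (hg'.intervalIntegrable _ _)
    have h1 := hΔf i 0
    have h2 := hΔg i 0
    rw [zero_add] at h1 h2
    have h3 : (∫ x in (0:ℝ)..(2 * Real.pi), deriv (f i) x * g i x)
        = ∫ x in (0:ℝ)..(2 * Real.pi), g i x * deriv (f i) x := by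
      simp only [mul_comm]
    rw [h3, h1, h2] at h
    unfold Sform
    rw [h]
    ring
  have e1 : (∑ i, ε i * Sform (f i) (g i) (Δf i) (Δg i))
      = - ∑ i, ε i * Sform (g i) (f i) (Δg i) (Δf i) := by
    rw [← Finset.sum_neg_distrib]
    refine Finset.sum_congr rfl fun i _ => ?_
    rw [key i]
    ring
  have e2 : (∑ i, ∑ j ∈ Finset.univ.filter (fun j => r i j),
        ε i * ε j * (Δf i * Δg j - Δg i * Δf j))
      = - ∑ i, ∑ j ∈ Finset.univ.filter (fun j => r i j),
        ε i * ε j * (Δg i * Δf j - Δf i * Δg j) := by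
    simp only [← Finset.sum_neg_distrib]
    refine Finset.sum_congr rfl fun i _ => Finset.sum_congr rfl fun j _ => ?_
    ring
  unfold SA
  rw [e1, e2]
  ring
end

section
/- The form S_< depends only on the cyclic order of A: let A be a finite set with strict linear order <, let m be the least element of A, and let <′ be the strict linear order on A in which m is the greatest element while the relative order of all other elements is unchanged. Let ε : A → {−1, +1} and let (f_i)_{i∈A}, (g_i)_{i∈A} be families of quasi-periodic functions satisfying Σ_{i∈A} ε_i·Δ_{f_i} = 0 and Σ_{i∈A} ε_i·Δ_{g_i} = 0. Then S_<(f,g) = S_{<′}(f,g). -/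
/-- `S_<` depends only on the cyclic order of `A`: if `m` is the least
element of the strict linear order `r`, and `r'` is the strict linear order in which `m`
becomes the greatest element while the relative order of all other elements is unchanged,
then for sign functions `ε` and families `f`, `g` of quasi-periodic functions with
`Σ ε_i·Δ_{f_i} = 0` and `Σ ε_i·Δ_{g_i} = 0`, we have `S_<(f,g) = S_{<'}(f,g)`. -/
theorem statement5 {A : Type*} [Fintype A] (r r' : A → A → Prop)
    [DecidableRel r] [DecidableRel r']
    (hr : IsStrictTotalOrder A r) (hr' : IsStrictTotalOrder A r')
    (m : A) (hm : ∀ i, i ≠ m → r m i)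
    (hrr' : ∀ i j, r' i j ↔ ((j = m ∧ i ≠ m) ∨ (i ≠ m ∧ j ≠ m ∧ r i j)))
    (ε : A → ℝ) (hε : ∀ i, ε i = 1 ∨ ε i = -1)
    (f g : A → ℝ → ℝ) (Δf Δg : A → ℝ)
    (hf : ∀ i, ContDiff ℝ 1 (f i)) (hg : ∀ i, ContDiff ℝ 1 (g i))
    (hΔf : ∀ i, ∀ x : ℝ, f i (x + 2 * Real.pi) = f i x + Δf i)
    (hΔg : ∀ i, ∀ x : ℝ, g i (x + 2 * Real.pi) = g i x + Δg i)
    (hsumf : ∑ i, ε i * Δf i = 0) (hsumg : ∑ i, ε i * Δg i = 0) :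
    SA r ε f g Δf Δg = SA r' ε f g Δf Δg := by
  classical
  have key : ∀ c : A → A → ℝ, (∑ j, c m j = 0) → (∑ i, c i m = 0) →
      ∑ i, ∑ j ∈ Finset.univ.filter (fun j => r i j), c i j =
      ∑ i, ∑ j ∈ Finset.univ.filter (fun j => r' i j), c i j := by
    intro c h1 h2
    simp only [Finset.sum_filter]
    have hp : ∀ i j, (if r i j then c i j else 0) = (if r' i j then c i j else 0)
        + (if i = m then c i j else 0) - (if j = m then c i j else 0) := by
      intro i j
      by_cases hi : i = m
      · subst hi
        by_cases hj : j = i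
        · subst hj
          have h3 : ¬ r j j := hr.irrefl j
          have h4 : ¬ r' j j := hr'.irrefl j
          simp [h3, h4]
        · have h3 := hm j hj
          have h4 : ¬ r' i j := by rw [hrr']; tauto
          simp [h3, h4, hj]
      · by_cases hj : j = m
        · subst hj
          have h3 : ¬ r i j := fun h => hr.irrefl j (hr.trans _ _ _ (hm i hi) h)
          have h4 : r' i j := by rw [hrr']; tauto
          simp [h3, h4, hi]
        · have h4 : r' i j ↔ r i j := by rw [hrr']; tauto
          simp [h4, hi, hj]
    simp only [hp, Finset.sum_add_distrib, Finset.sum_sub_distrib]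
    have e1 : ∑ i, ∑ j, (if i = m then c i j else 0) = 0 := by
      rw [Finset.sum_comm]
      simpa using h1
    have e2 : ∑ i, ∑ j, (if j = m then c i j else 0) = 0 := by
      simpa using h2
    rw [e1, e2]
    ring
  unfold SA
  rw [key]
  · have : ∀ j, ε m * ε j * (Δf m * Δg j - Δg m * Δf j) =
        ε m * Δf m * (ε j * Δg j) - ε m * Δg m * (ε j * Δf j) := fun j => by ring
    simp only [this, Finset.sum_sub_distrib, ← Finset.mul_sum, hsumf, hsumg]
    ring
  · have : ∀ i, ε i * ε m * (Δf i * Δg m - Δg i * Δf m) =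
        ε m * Δg m * (ε i * Δf i) - ε m * Δf m * (ε i * Δg i) := fun j => by ring
    simp only [this, Finset.sum_sub_distrib, ← Finset.mul_sum, hsumf, hsumg]
    ring
end

section
/- (Lemma on standard transformations.) Let A be a finite set equipped with two strict linear orders < and <′, let ε : A → {−1, +1}, and let (f_i)_{i∈A}, (g_i)_{i∈A} be families of quasi-periodic functions satisfying Σ_{i∈A} ε_i·Δ_{f_i} = 0 and Σ_{i∈A} ε_i·Δ_{g_i} = 0. Define the standard transformation f ↦ f′ by f′_i := f_i − Σ { ε_j·Δ_{f_j} : j < i and i <′ j } (subtraction of a constant from each f_i), and similarly g ↦ g′. Then S_<(f,g) = S_{<′}(f′,g′). -/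
/-- The standard transformation corresponding to the change of order from `r` to `r'`:
`f'_i = f_i − Σ { ε_j·Δ_{f_j} : r j i and r' i j }` (subtraction of a constant from each
`f_i`). -/
noncomputable def stdTransform {A : Type*} [Fintype A] (r r' : A → A → Prop)
    [DecidableRel r] [DecidableRel r'] (ε : A → ℝ) (Δf : A → ℝ) (f : A → ℝ → ℝ) :
    A → ℝ → ℝ :=
  fun i x => f i x - ∑ j ∈ Finset.univ.filter (fun j => r j i ∧ r' i j), ε j * Δf j

theorem Sform_sub_const (f g : ℝ → ℝ) (Δf Δg c d : ℝ)
    (hf : ContDiff ℝ 1 f) (hg : ContDiff ℝ 1 g)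
    (hΔg : ∀ x : ℝ, g (x + 2 * Real.pi) = g x + Δg) :
    Sform (fun x => f x - c) (fun x => g x - d) Δf Δg
      = Sform f g Δf Δg - c * Δg + Δf * d := by
  have hc : Continuous (deriv g) := hg.continuous_deriv le_rfl
  have h1 : ∫ x in (0:ℝ)..(2 * Real.pi), deriv g x = Δg := by
    rw [intervalIntegral.integral_deriv_eq_sub
      (fun x _ => (hg.differentiable one_ne_zero) x) (hc.intervalIntegrable _ _)]
    have := hΔg 0
    rw [zero_add] at this
    rw [this]; ring
  have h2 : ∫ x in (0:ℝ)..(2 * Real.pi), (f x - c) * deriv g x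
      = (∫ x in (0:ℝ)..(2 * Real.pi), f x * deriv g x) - c * Δg := by
    simp only [sub_mul]
    have i1 : Continuous fun x => f x * deriv g x := hf.continuous.mul hc
    have i2 : Continuous fun x => c * deriv g x := continuous_const.mul hc
    rw [intervalIntegral.integral_sub (i1.intervalIntegrable _ _) (i2.intervalIntegrable _ _),
      intervalIntegral.integral_const_mul, h1]
  simp only [Sform, deriv_sub_const_fun]
  rw [h2]; ring

theorem order_change_sum {A : Type*} [Fintype A] (r r' : A → A → Prop)
    [DecidableRel r] [DecidableRel r']
    (hr : IsStrictTotalOrder A r) (hr' : IsStrictTotalOrder A r')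
    (w : A → A → ℝ) (hw : ∀ i j, w j i = - w i j) :
    (∑ i, ∑ j, if r' i j then w i j else 0) - (∑ i, ∑ j, if r i j then w i j else 0)
      = 2 * ∑ i, ∑ j, if r j i ∧ r' i j then w i j else 0 := by
  have hs : (∑ i, ∑ j, if r j i ∧ r' i j then w i j else 0)
      = ∑ i, ∑ j, if r i j ∧ r' j i then w j i else 0 := Finset.sum_comm
  rw [two_mul]
  nth_rewrite 2 [hs]
  simp only [← Finset.sum_sub_distrib, ← Finset.sum_add_distrib]
  refine Finset.sum_congr rfl fun i _ => Finset.sum_congr rfl fun j _ => ?_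
  have a1 : r i j → ¬ r j i := fun h h' => hr.irrefl i (hr.trans _ _ _ h h')
  have a2 : r' i j → ¬ r' j i := fun h h' => hr'.irrefl i (hr'.trans _ _ _ h h')
  have t1 : r i j ∨ i = j ∨ r j i := by
    by_contra! h
    exact h.2.1 (hr.trichotomous i j h.1 h.2.2)
  have t2 : r' i j ∨ i = j ∨ r' j i := by
    by_contra! h
    exact h.2.1 (hr'.trichotomous i j h.1 h.2.2)
  by_cases e : i = j
  · subst e
    have := hr.irrefl i
    have := hr'.irrefl i
    simp [*]
  · rw [hw i j]
    clear hw hs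
    by_cases b1 : r i j <;> by_cases b2 : r' i j <;> by_cases b3 : r j i <;>
      by_cases b4 : r' j i <;> simp_all

/-- Lemma on standard transformations: for two strict linear orders `r`, `r'`
on a finite set `A`, a sign function `ε : A → {−1,+1}` and families `f`, `g` of
quasi-periodic functions with `Σ ε_i·Δ_{f_i} = 0` and `Σ ε_i·Δ_{g_i} = 0`, we have
`S_<(f,g) = S_{<'}(f',g')` where `f ↦ f'`, `g ↦ g'` is the standard transformation
corresponding to the change of order from `r` to `r'` (the degrees are unchanged). -/
theorem statement6 {A : Type*} [Fintype A] (r r' : A → A → Prop)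
    [DecidableRel r] [DecidableRel r']
    (hr : IsStrictTotalOrder A r) (hr' : IsStrictTotalOrder A r')
    (ε : A → ℝ) (hε : ∀ i, ε i = 1 ∨ ε i = -1)
    (f g : A → ℝ → ℝ) (Δf Δg : A → ℝ)
    (hf : ∀ i, ContDiff ℝ 1 (f i)) (hg : ∀ i, ContDiff ℝ 1 (g i))
    (hΔf : ∀ i, ∀ x : ℝ, f i (x + 2 * Real.pi) = f i x + Δf i)
    (hΔg : ∀ i, ∀ x : ℝ, g i (x + 2 * Real.pi) = g i x + Δg i)
    (hsumf : ∑ i, ε i * Δf i = 0) (hsumg : ∑ i, ε i * Δg i = 0) :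
    SA r ε f g Δf Δg =
      SA r' ε (stdTransform r r' ε Δf f) (stdTransform r r' ε Δg g) Δf Δg := by
  have hT : ∀ i, Sform (stdTransform r r' ε Δf f i) (stdTransform r r' ε Δg g i) (Δf i) (Δg i)
      = Sform (f i) (g i) (Δf i) (Δg i)
        - (∑ j ∈ Finset.univ.filter (fun j => r j i ∧ r' i j), ε j * Δf j) * Δg i
        + Δf i * (∑ j ∈ Finset.univ.filter (fun j => r j i ∧ r' i j), ε j * Δg j) :=
    fun i => Sform_sub_const (f i) (g i) (Δf i) (Δg i) _ _ (hf i) (hg i) (hΔg i)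
  have key := order_change_sum r r' hr hr'
    (fun i j => ε i * ε j * (Δf i * Δg j - Δg i * Δf j)) (fun i j => by ring)
  simp only [← Finset.sum_filter] at key
  have hD : ∑ i, ε i * Sform (stdTransform r r' ε Δf f i) (stdTransform r r' ε Δg g i)
        (Δf i) (Δg i)
      = ∑ i, ε i * Sform (f i) (g i) (Δf i) (Δg i)
        + ∑ i, ∑ j ∈ Finset.univ.filter (fun j => r j i ∧ r' i j),
          ε i * ε j * (Δf i * Δg j - Δg i * Δf j) := by
    rw [← Finset.sum_add_distrib]
    refine Finset.sum_congr rfl fun i _ => ?_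
    rw [hT i]
    have : ∑ j ∈ Finset.univ.filter (fun j => r j i ∧ r' i j),
          ε i * ε j * (Δf i * Δg j - Δg i * Δf j)
        = ε i * Δf i * (∑ j ∈ Finset.univ.filter (fun j => r j i ∧ r' i j), ε j * Δg j)
        - ε i * Δg i * (∑ j ∈ Finset.univ.filter (fun j => r j i ∧ r' i j), ε j * Δf j) := by
      rw [Finset.mul_sum, Finset.mul_sum, ← Finset.sum_sub_distrib]
      exact Finset.sum_congr rfl fun j _ => by ring
    rw [this]; ring
  unfold SA
  rw [hD]
  linarith
end

section
/- (Invariance of S under moving a cancelling adjacent pair.) Let A be a finite set, ε : A → {−1, +1}, and let <, <′ be two strict linear orders on A, and p, q ∈ A distinct elements, such that: p < q and q is the immediate <-successor of p; p <′ q and q is the immediate <′-successor of p; and < and <′ restrict to the same order on A ∖ {p, q}. Let (f_i)_{i∈A}, (g_i)_{i∈A} be families of quasi-periodic functions with ε_q = −ε_p, Δ_{f_p} = Δ_{f_q}, and Δ_{g_p} = Δ_{g_q}. Then S_<(f,g) = S_{<′}(f,g). -/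
open Classical in
theorem sum_split_pair {A : Type*} [Fintype A] (p q : A) (hpq : p ≠ q) (F : A → ℝ) :
    ∑ i, F i = F p + F q + ∑ i ∈ Finset.univ \ {p, q}, F i := by
  rw [← Finset.sum_sdiff (Finset.subset_univ ({p, q} : Finset A)), Finset.sum_pair hpq, add_comm]

open Classical in
theorem pair_sum_reduce {A : Type*} [Fintype A] (r : A → A → Prop) [DecidableRel r]
    (hr : IsStrictTotalOrder A r) (p q : A) (hpq : p ≠ q)
    (hadj : r p q ∧ ∀ k, ¬ (r p k ∧ r k q))
    (ε : A → ℝ) (hεq : ε q = - ε p) (Δf Δg : A → ℝ)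
    (hΔfpq : Δf p = Δf q) (hΔgpq : Δg p = Δg q) :
    (∑ i, ∑ j ∈ Finset.univ.filter (fun j => r i j),
      ε i * ε j * (Δf i * Δg j - Δg i * Δf j)) =
    ∑ i ∈ Finset.univ \ {p, q}, ∑ j ∈ Finset.univ \ {p, q},
      if r i j then ε i * ε j * (Δf i * Δg j - Δg i * Δf j) else 0 := by
  obtain ⟨h1, h2⟩ := hadj
  have htr : ∀ a b c, r a b → r b c → r a c := fun a b c => hr.toIsStrictOrder.toIsTrans.trans a b c
  have htri : ∀ a b, r a b ∨ a = b ∨ r b a := fun a b => by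
    by_contra hc
    push Not at hc
    exact hc.2.1 (hr.toTrichotomous.trichotomous a b hc.1 hc.2.2)
  have hL : ∀ i, i ≠ p → i ≠ q → (r i p ↔ r i q) := fun i hip hiq =>
    ⟨fun h => htr _ _ _ h h1, fun h => by
      rcases htri i p with hcase | hcase | hcase
      · exact hcase
      · exact absurd hcase hip
      · exact absurd ⟨hcase, h⟩ (h2 i)⟩
  have hR : ∀ i, i ≠ p → i ≠ q → (r p i ↔ r q i) := fun i hip hiq =>
    ⟨fun h => by
      rcases htri i q with hcase | hcase | hcase
      · exact absurd ⟨h, hcase⟩ (h2 i)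
      · exact absurd hcase hiq
      · exact hcase, fun h => htr _ _ _ h1 h⟩
  simp only [Finset.sum_filter]
  rw [sum_split_pair p q hpq, ← Finset.sum_add_distrib]
  have e1 : (∑ i, ((if r p i then ε p * ε i * (Δf p * Δg i - Δg p * Δf i) else 0) +
      (if r q i then ε q * ε i * (Δf q * Δg i - Δg q * Δf i) else 0))) = 0 := by
    apply Finset.sum_eq_zero
    intro i _
    by_cases hip : i = p
    · subst hip
      rw [hεq, hΔfpq, hΔgpq]
      split_ifs <;> ring
    by_cases hiq : i = q
    · subst hiq
      rw [hεq, hΔfpq, hΔgpq]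
      split_ifs <;> ring
    simp only [hR i hip hiq, hεq, hΔfpq, hΔgpq]
    split_ifs <;> ring
  rw [e1, zero_add]
  apply Finset.sum_congr rfl
  intro i hi
  simp only [Finset.mem_sdiff, Finset.mem_univ, true_and, Finset.mem_insert,
    Finset.mem_singleton, not_or] at hi
  rw [sum_split_pair p q hpq]
  simp only [hL i hi.1 hi.2, hεq, hΔfpq, hΔgpq]
  split_ifs <;> ring

/-- Invariance of `S` under moving a cancelling adjacent pair: let `r`, `r'`
be two strict linear orders on the finite set `A` and `p ≠ q` elements of `A` such that `q`
is the immediate successor of `p` in both `r` and `r'`, and `r`, `r'` restrict to the same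
order on `A ∖ {p,q}`. If `ε_q = −ε_p`, `Δ_{f_p} = Δ_{f_q}` and `Δ_{g_p} = Δ_{g_q}`, then
`S_<(f,g) = S_{<'}(f,g)`. -/
theorem statement8 {A : Type*} [Fintype A] (r r' : A → A → Prop)
    [DecidableRel r] [DecidableRel r']
    (hr : IsStrictTotalOrder A r) (hr' : IsStrictTotalOrder A r')
    (p q : A) (hpq : p ≠ q)
    (hadj : r p q ∧ ∀ k, ¬ (r p k ∧ r k q))
    (hadj' : r' p q ∧ ∀ k, ¬ (r' p k ∧ r' k q))
    (hrest : ∀ i j, i ≠ p → i ≠ q → j ≠ p → j ≠ q → (r i j ↔ r' i j))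
    (ε : A → ℝ) (hε : ∀ i, ε i = 1 ∨ ε i = -1) (hεq : ε q = - ε p)
    (f g : A → ℝ → ℝ) (Δf Δg : A → ℝ)
    (hf : ∀ i, ContDiff ℝ 1 (f i)) (hg : ∀ i, ContDiff ℝ 1 (g i))
    (hΔf : ∀ i, ∀ x : ℝ, f i (x + 2 * Real.pi) = f i x + Δf i)
    (hΔg : ∀ i, ∀ x : ℝ, g i (x + 2 * Real.pi) = g i x + Δg i)
    (hΔfpq : Δf p = Δf q) (hΔgpq : Δg p = Δg q) :
    SA r ε f g Δf Δg = SA r' ε f g Δf Δg := by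
  classical
  unfold SA
  rw [pair_sum_reduce r hr p q hpq hadj ε hεq Δf Δg hΔfpq hΔgpq,
    pair_sum_reduce r' hr' p q hpq hadj' ε hεq Δf Δg hΔfpq hΔgpq]
  congr 2
  apply Finset.sum_congr (by congr)
  intro i hi
  apply Finset.sum_congr (by congr)
  intro j hj
  simp only [Finset.mem_sdiff, Finset.mem_univ, true_and, Finset.mem_insert,
    Finset.mem_singleton, not_or] at hi hj
  simp only [hrest i j hi.1 hi.2 hj.1 hj.2]
end

section
/- (Standard transformations of moves past a cancelling adjacent pair are identities.) Let A be a finite set, ε : A → {−1, +1}, let < be a strict linear order on A, and let p, q, k ∈ A be distinct elements such that q is the immediate <-successor of p and k is the immediate <-successor of q. Let <′ be the strict linear order on A obtained from < by moving k to the position immediately preceding p, leaving all other relative positions unchanged. Let (f_i)_{i∈A} be a family of quasi-periodic functions with ε_q = −ε_p and Δ_{f_p} = Δ_{f_q}. Then the standard transformation from < to <′ is the identity: f′_i = f_i for all i ∈ A. -/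
/-- Standard transformations of moves past a cancelling adjacent pair are
identities: let `r` be a strict linear order on the finite set `A` and `p, q, k` distinct
elements with `q` the immediate `r`-successor of `p` and `k` the immediate `r`-successor of
`q`. Let `r'` be the strict linear order obtained from `r` by moving `k` to the position
immediately preceding `p`, leaving all other relative positions unchanged (so: the
elements `r'`-after `k` are exactly `p` and the elements `r`-after `p`, the elements
`r'`-before `k` are exactly those `r`-before `p`, and `r'` agrees with `r` on pairs not
involving `k`). If `ε_q = −ε_p` and `Δ_{f_p} = Δ_{f_q}` for a family `f` of quasi-periodic
functions, then the standard transformation from `r` to `r'` is the identity. -/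
theorem statement9 {A : Type*} [Fintype A] (r r' : A → A → Prop)
    [DecidableRel r] [DecidableRel r']
    (hr : IsStrictTotalOrder A r) (hr' : IsStrictTotalOrder A r')
    (p q k : A) (hpq : p ≠ q) (hpk : p ≠ k) (hqk : q ≠ k)
    (hadj1 : r p q ∧ ∀ j, ¬ (r p j ∧ r j q))
    (hadj2 : r q k ∧ ∀ j, ¬ (r q j ∧ r j k))
    (hrr' : ∀ i j, r' i j ↔
      ((i ≠ k ∧ j ≠ k ∧ r i j) ∨ (i = k ∧ j ≠ k ∧ (j = p ∨ r p j)) ∨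
        (i ≠ k ∧ j = k ∧ r i p)))
    (ε : A → ℝ) (hε : ∀ i, ε i = 1 ∨ ε i = -1) (hεq : ε q = - ε p)
    (f : A → ℝ → ℝ) (Δf : A → ℝ)
    (hf : ∀ i, ContDiff ℝ 1 (f i))
    (hΔf : ∀ i, ∀ x : ℝ, f i (x + 2 * Real.pi) = f i x + Δf i)
    (hΔfpq : Δf p = Δf q) :
    ∀ i, stdTransform r r' ε Δf f i = f i := by
  classical
  have htr : ∀ a b c, r a b → r b c → r a c := fun a b c => hr.toIsStrictOrder.toIsTrans.trans a b c
  have hirr : ∀ a, ¬ r a a := fun a => hr.toIsStrictOrder.toIrrefl.irrefl a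
  have htri : ∀ a b, r a b ∨ a = b ∨ r b a := fun a b => by
    by_contra h
    push Not at h
    exact h.2.1 (hr.toTrichotomous.trichotomous a b h.1 h.2.2)
  obtain ⟨h1, h1'⟩ := hadj1
  obtain ⟨h2, h2'⟩ := hadj2
  intro i
  funext x
  unfold stdTransform
  by_cases hik : i = k
  · subst hik
    have hset : Finset.univ.filter (fun j => r j i ∧ r' i j) = {p, q} := by
      ext j
      simp only [Finset.mem_filter, Finset.mem_univ, true_and, Finset.mem_insert,
        Finset.mem_singleton]
      rw [hrr']
      constructor
      · rintro ⟨hji, h⟩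
        have hj : j = p ∨ r p j := by tauto
        rcases hj with hj | hj
        · exact Or.inl hj
        · rcases htri j q with h3 | h3 | h3
          · exact absurd ⟨hj, h3⟩ (h1' j)
          · exact Or.inr h3
          · exact absurd ⟨h3, hji⟩ (h2' j)
      · rintro (rfl | rfl)
        · exact ⟨htr _ _ _ h1 h2, Or.inr (Or.inl ⟨rfl, hpk, Or.inl rfl⟩)⟩
        · exact ⟨h2, Or.inr (Or.inl ⟨rfl, hqk, Or.inr h1⟩)⟩
    rw [hset, Finset.sum_pair hpq, hεq, hΔfpq]
    ring
  · have hset : Finset.univ.filter (fun j => r j i ∧ r' i j) = ∅ := by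
      ext j
      simp only [Finset.mem_filter, Finset.mem_univ, true_and, Finset.notMem_empty,
        iff_false, hrr']
      rintro ⟨hji, ⟨_, _, h⟩ | ⟨h, _⟩ | ⟨_, rfl, h⟩⟩
      · exact hirr _ (htr _ _ _ hji h)
      · exact hik h
      · exact hirr _ (htr _ _ _ (htr _ _ _ (htr _ _ _ hji h) h1) h2)
    rw [hset]
    simp
end
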